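/- arXiv:2311.05116 — 3 statements merged into one kernel-verified Lean document; each statement's English description precedes it below -/
import Mathlib

section
/- Let n, N ≥ 1 and d ≥ 1 be integers and let p : ℝ^n → ℝ^N be a polynomial map of degree at most d. Then for every affine subspace L ⊆ ℝ^N, the set im(p) ∩ L, equipped with the subspace topology, has at most (2d)^n connected components. -/
/-- The polynomial map `ℝ^n → ℝ^N` whose coordinate functions are the
polynomials `P i`. -/
noncomputable def polyMap {n N : ℕ} (P : Fin N → MvPolynomial (Fin n) ℝ)
    (x : Fin n → ℝ) : EuclideanSpace ℝ (Fin N) :=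
  WithLp.toLp 2 fun i => MvPolynomial.eval x (P i)

open MvPolynomial in
/-- A partial derivative lowers the total degree. -/
theorem MvPolynomial.totalDegree_pderiv_le {σ R : Type*} [CommSemiring R] (i : σ)
    (p : MvPolynomial σ R) : (pderiv i p).totalDegree ≤ p.totalDegree - 1 := by
  refine Finset.sup_le fun s hs => ?_
  have hs' : s + Finsupp.single i 1 ∈ p.support := by
    rw [mem_support_iff, coeff_pderiv] at hs
    exact mem_support_iff.2 (left_ne_zero_of_mul hs)
  have h := le_totalDegree hs'
  rw [Finsupp.sum_add_index' (fun _ => rfl) (fun _ _ _ => rfl),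
    Finsupp.sum_single_index rfl] at h
  omega

open MvPolynomial in
/-- The formal partial derivative computes the derivative along a coordinate line. -/
theorem MvPolynomial.hasDerivAt_eval_update {σ : Type*} [DecidableEq σ] (p : MvPolynomial σ ℝ)
    (x : σ → ℝ) (i : σ) :
    HasDerivAt (fun t => eval (Function.update x i t) p) (eval x (pderiv i p)) (x i) := by
  induction p using MvPolynomial.induction_on with
  | C a => simpa using hasDerivAt_const (x i) a
  | add p q hp hq =>
    simp only [map_add]
    exact hp.fun_add hq
  | mul_X p j hp =>
    have hX : HasDerivAt (fun t => Function.update x i t j) (eval x (pderiv i (X j))) (x i) := by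
      by_cases h : j = i
      · subst h
        simpa using hasDerivAt_id' (x j)
      · simpa [h, pderiv_X_of_ne h] using hasDerivAt_const (x i) (x j)
    have h := hp.mul hX
    simp only [Function.update_eq_self] at h
    convert! h using 1
    · ext t
      simp
    · rw [pderiv_mul, map_add, map_mul, map_mul, eval_X]

open MvPolynomial in
theorem MvPolynomial.eval_pderiv_eq_zero_of_isLocalMin {σ : Type*} {p : MvPolynomial σ ℝ}
    {x : σ → ℝ} (hx : IsLocalMin (fun y => eval y p) x) (i : σ) : eval x (pderiv i p) = 0 := by
  classical
  refine IsLocalMin.hasDerivAt_eq_zero ?_ (p.hasDerivAt_eval_update x i)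
  have hc : Filter.Tendsto (fun t => Function.update x i t) (nhds (x i)) (nhds x) := by
    have : Continuous fun t => Function.update x i t := by fun_prop
    simpa using this.tendsto (x i)
  have := hc.eventually hx
  simpa [IsLocalMin, IsMinFilter] using this

open MvPolynomial in
/-- Among `k` distinct points, each one is singled out by a polynomial of degree at most `k` which
vanishes exactly at the others. -/
theorem MvPolynomial.exists_totalDegree_le_eval_eq_zero_iff_ne {σ K : Type*} [Field K] {k : ℕ}
    {z : Fin k → σ → K} (hz : Function.Injective z) (j : Fin k) :
    ∃ p : MvPolynomial σ K, p.totalDegree ≤ k ∧ ∀ l, eval (z l) p = 0 ↔ l ≠ j := by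
  have hsep : ∀ l, ∃ q : MvPolynomial σ K, q.totalDegree ≤ 1 ∧ eval (z l) q = 0 ∧
      (l ≠ j → eval (z j) q ≠ 0) := fun l => by
    by_cases hl : l = j
    · exact ⟨0, by simp, by simp, fun h => absurd hl h⟩
    · obtain ⟨i, hi⟩ := Function.ne_iff.1 (hz.ne hl)
      exact ⟨X i - C (z l i), (totalDegree_sub_C_le _ _).trans (totalDegree_X _).le, by simp,
        fun _ => by simpa [sub_eq_zero] using hi.symm⟩
  choose q hqdeg hql hqj using hsep
  refine ⟨∏ l ∈ Finset.univ.erase j, q l, ?_, fun l => ?_⟩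
  · exact (totalDegree_finsetProd _ _).trans
      ((Finset.sum_le_card_nsmul _ _ 1 fun l _ => hqdeg l).trans (by simp))
  · rw [map_prod, Finset.prod_eq_zero_iff]
    constructor
    · rintro ⟨a, ha, h⟩ rfl
      exact hqj a (Finset.ne_of_mem_erase ha) h
    · intro h
      exact ⟨l, by simp [h], hql l⟩

open MvPolynomial in
/-- A Bézout bound: for polynomials `a i` of degree at most `m` and all but finitely many `ε`, the
system `a i + ε * X i ^ m = 0` does not have `k` distinct solutions if `k` exceeds `m ^ n`. -/
theorem MvPolynomial.finite_setOf_card_solutions_gt {σ K : Type*} [Fintype σ] [Field K]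
    (a : σ → MvPolynomial σ K) (m : ℕ) (ha : ∀ i, (a i).totalDegree ≤ m) (k : ℕ)
    (hk : m ^ Fintype.card σ < k) :
    {ε : K | ∃ z : Fin k → σ → K, Function.Injective z ∧
      ∀ j i, eval (z j) (a i) + ε * z j i ^ m = 0}.Finite := by
  classical
  -- `A` replaces a factor `X i ^ m` of a monomial by `a i`, and kills the reduced monomials.
  let A : Module.End K (MvPolynomial σ K) := (basisMonomials σ K).constr K fun s =>
    if hs : ∃ i, m ≤ s i then monomial (s - Finsupp.single hs.choose m) 1 * a hs.choose else 0
  have hA : ∀ s, A (monomial s 1) = if hs : ∃ i, m ≤ s i then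
      monomial (s - Finsupp.single hs.choose m) 1 * a hs.choose else 0 := fun s => by
    have := (basisMonomials σ K).constr_basis K (fun s : σ →₀ ℕ =>
      if hs : ∃ i, m ≤ s i then monomial (s - Finsupp.single hs.choose m) 1 * a hs.choose else 0) s
    rwa [coe_basisMonomials] at this
  let V := restrictTotalDegree σ K k
  have hAV : ∀ p ∈ V, A p ∈ V := by
    suffices V ≤ V.comap A from this
    refine (restrictSupport_eq_span (R := K) _).le.trans (Submodule.span_le.2 ?_)
    rintro _ ⟨s, hs, rfl⟩
    simp only [SetLike.mem_coe, Submodule.mem_comap, hA]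
    split_ifs with h
    · rw [mem_restrictTotalDegree]
      have hle : Finsupp.single h.choose m ≤ s := by simpa using h.choose_spec
      have hsum : (s - Finsupp.single h.choose m).sum (fun _ e => e) + m
          = s.sum fun _ e => e := by
        conv_rhs => rw [← tsub_add_cancel_of_le hle]
        rw [Finsupp.sum_add_index' (fun _ => rfl) (fun _ _ _ => rfl), Finsupp.sum_single_index rfl]
      have h1 := totalDegree_monomial (s - Finsupp.single h.choose m) (one_ne_zero (α := K))
      have h2 := totalDegree_mul (monomial (s - Finsupp.single h.choose m) (1 : K)) (a h.choose)
      have h3 := ha h.choose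
      have h4 : (s.sum fun _ e => e) ≤ k := hs
      omega
    · exact V.zero_mem
  let B : Module.End K V := A.restrict hAV
  refine (B.finite_hasEigenvalue.image fun μ => -μ).subset ?_
  rintro ε ⟨z, hz, hzero⟩
  refine ⟨-ε, ?_, neg_neg ε⟩
  by_contra hε
  let T : Module.End K V := B + ε • 1
  have hT : Function.Surjective T := by
    refine LinearMap.injective_iff_surjective.1 ((injective_iff_map_eq_zero T).2 fun v hv => ?_)
    by_contra hv0
    refine hε (Module.End.hasEigenvalue_of_hasEigenvector (x := v) ⟨?_, hv0⟩)
    rw [Module.End.mem_eigenspace_iff, neg_smul]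
    exact eq_neg_of_add_eq_zero_left hv
  let ev : MvPolynomial σ K →ₗ[K] (Fin k → K) := LinearMap.pi fun j => (aeval (z j)).toLinearMap
  have hev : ∀ p j, ev p j = eval (z j) p := fun p j => by simp [ev, aeval_eq_eval]
  let Φ : MvPolynomial σ K →ₗ[K] (Fin k → K) := ev ∘ₗ (A + ε • 1)
  have hΦ : ∀ s : σ →₀ ℕ, (∃ i, m ≤ s i) → Φ (monomial s 1) = 0 := by
    intro s hs
    have hle : Finsupp.single hs.choose m ≤ s := by simpa using hs.choose_spec
    have hmon : (monomial s (1 : K)) =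
        monomial (s - Finsupp.single hs.choose m) 1 * X hs.choose ^ m := by
      rw [X_pow_eq_monomial, monomial_mul, tsub_add_cancel_of_le hle, one_mul]
    ext j
    have : (A + ε • 1) (monomial s 1) =
        monomial (s - Finsupp.single hs.choose m) 1 * (a hs.choose + C ε * X hs.choose ^ m) := by
      rw [LinearMap.add_apply, hA, dif_pos hs, LinearMap.smul_apply, Module.End.one_apply,
        smul_eq_C_mul]
      conv_lhs => rw [hmon]
      ring
    simp only [Φ, LinearMap.comp_apply, this, hev, map_mul, map_add, eval_C, map_pow, eval_X,
      hzero, mul_zero, Pi.zero_apply]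
  have hsurj : LinearMap.range Φ = ⊤ := by
    rw [← top_le_iff, ← (Pi.basisFun K (Fin k)).span_eq, Submodule.span_le]
    rintro _ ⟨j, rfl⟩
    obtain ⟨p, hp, hpz⟩ := exists_totalDegree_le_eval_eq_zero_iff_ne hz j
    obtain ⟨v, hv⟩ := hT ⟨p, (mem_restrictTotalDegree _ _ _).2 hp⟩
    have hv' : (A + ε • 1) (v : MvPolynomial σ K) = p := congrArg Subtype.val hv
    refine ⟨(eval (z j) p)⁻¹ • (v : MvPolynomial σ K), ?_⟩
    ext l
    rw [map_smul, Pi.smul_apply, LinearMap.comp_apply, hv', hev, Pi.basisFun_apply, smul_eq_mul]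
    by_cases hl : l = j
    · subst hl
      have : eval (z l) p ≠ 0 := fun h => (hpz l).1 h rfl
      simp [this]
    · simp [hl, (hpz l).2 hl]
  let r : (σ → Fin m) → (Fin k → K) := fun f =>
    Φ (monomial (Finsupp.equivFunOnFinite.symm fun i => (f i : ℕ)) 1)
  have hspan : LinearMap.range Φ ≤ Submodule.span K (Set.range r) := by
    rw [LinearMap.range_eq_map, ← (basisMonomials σ K).span_eq, Submodule.map_span,
      Submodule.span_le]
    rintro _ ⟨_, ⟨s, rfl⟩, rfl⟩
    rw [coe_basisMonomials]
    by_cases hs : ∃ i, m ≤ s i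
    · exact (hΦ s hs).symm ▸ Submodule.zero_mem _
    · push Not at hs
      refine Submodule.subset_span ⟨fun i => ⟨s i, hs i⟩, ?_⟩
      simp only [r]
      congr
      ext i
      simp
  have hcard := finrank_range_le_card (R := K) r
  have htop : Submodule.span K (Set.range r) = ⊤ := top_le_iff.1 (hsurj ▸ hspan)
  rw [Set.finrank, htop, finrank_top, Module.finrank_fin_fun,
    Fintype.card_fun, Fintype.card_fin] at hcard
  omega

/-- If `F ≥ 0` vanishes at a point `z` with `u z < c` and is nonzero on `{u = c}`, then for small
`ε > 0` the perturbation `F + ε * h` by a proper `h ≥ 0` has a local minimum in `{u < c}`. -/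
theorem exists_isLocalMin_add_mul {X : Type*} [TopologicalSpace X] {F h u : X → ℝ} {c : ℝ}
    (hF : Continuous F) (hh : Continuous h) (hu : Continuous u) (hF0 : ∀ x, 0 ≤ F x)
    (hh0 : ∀ x, 0 ≤ h x) (hcpt : ∀ R, IsCompact {x | h x ≤ R}) {z : X} (hFz : F z = 0)
    (huz : u z < c) (huF : ∀ x, u x = c → F x ≠ 0) :
    ∃ δ > 0, ∀ ε, 0 < ε → ε < δ → ∃ x, u x < c ∧ IsLocalMin (fun y => F y + ε * h y) x := by
  set R := h z + 1 with hR
  have hRpos : 0 < R := by have := hh0 z; positivity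
  obtain ⟨η, hη, hηF⟩ : ∃ η > 0, ∀ x, h x ≤ R → u x = c → η ≤ F x := by
    have hK : IsCompact ({x | h x ≤ R} ∩ {x | u x = c}) :=
      (hcpt R).inter_right (isClosed_eq hu continuous_const)
    rcases Set.eq_empty_or_nonempty ({x | h x ≤ R} ∩ {x | u x = c}) with he | hne
    · exact ⟨1, one_pos, fun x h1 h2 => absurd (show x ∈ {x | h x ≤ R} ∩ {x | u x = c} from
        ⟨h1, h2⟩) (he ▸ Set.notMem_empty x)⟩
    · obtain ⟨x, hx, hmin⟩ := hK.exists_isMinOn hne hF.continuousOn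
      exact ⟨F x, (hF0 x).lt_of_ne' (huF x hx.2), fun y h1 h2 => hmin ⟨h1, h2⟩⟩
  refine ⟨η / R, by positivity, fun ε hε hεδ => ?_⟩
  rw [lt_div_iff₀ hRpos] at hεδ
  have hK : IsCompact ({x | h x ≤ R} ∩ {x | u x ≤ c}) :=
    (hcpt R).inter_right (isClosed_le hu continuous_const)
  have hzK : z ∈ {x | h x ≤ R} ∩ {x | u x ≤ c} := ⟨by simp [hR], huz.le⟩
  have hcont : Continuous fun y => F y + ε * h y := by fun_prop
  obtain ⟨x, ⟨hxR, hxu⟩, hmin⟩ := hK.exists_isMinOn ⟨z, hzK⟩ hcont.continuousOn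
  have hle : F x + ε * h x ≤ F z + ε * h z := hmin hzK
  simp only [Set.mem_ofPred_eq] at hxR hxu
  have hxu' : u x < c := by
    refine hxu.lt_of_ne fun he => ?_
    have h1 := hηF x hxR he
    have h2 := mul_nonneg hε.le (hh0 x)
    nlinarith
  have hxR' : h x < R := by
    refine hxR.lt_of_ne fun he => ?_
    have h1 := hF0 x
    rw [he] at hle
    nlinarith
  refine ⟨x, hxu', ?_⟩
  filter_upwards [(isOpen_lt hh continuous_const).mem_nhds hxR',
    (isOpen_lt hu continuous_const).mem_nhds hxu'] with y h1 h2
  exact hmin ⟨le_of_lt h1, le_of_lt h2⟩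

theorem isCompact_setOf_sum_pow_le {ι : Type*} [Fintype ι] {k : ℕ} (hk : Even k) (hk0 : k ≠ 0)
    (R : ℝ) : IsCompact {x : ι → ℝ | ∑ i, x i ^ k ≤ R} := by
  refine (isCompact_univ_pi fun _ : ι =>
    isCompact_Icc (a := -(1 + |R|)) (b := 1 + |R|)).of_isClosed_subset
    (isClosed_le (by fun_prop) continuous_const) fun x hx i _ => ?_
  refine abs_le.1 ?_
  by_contra! hlt
  have h1 : x i ^ k ≤ R := (Finset.single_le_sum (f := fun i => x i ^ k)
    (fun j _ => hk.pow_nonneg (x j)) (Finset.mem_univ i)).trans hx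
  have h2 : |x i| ≤ |x i| ^ k := le_self_pow₀ (by linarith [abs_nonneg R]) hk0
  rw [hk.pow_abs] at h2
  linarith [le_abs_self R]

/-- A space which cannot be split into more than `M` clopen pieces has at most `M` connected
components. -/
theorem card_connectedComponents_le {X : Type*} [TopologicalSpace X] (M : ℕ)
    (hM : ∀ (k : ℕ) (f : X → Fin k), Continuous f → Function.Surjective f → k ≤ M) :
    Finite (ConnectedComponents X) ∧ Nat.card (ConnectedComponents X) ≤ M := by
  classical
  let Q : ℕ → Prop := fun k => ∃ f : X → Fin k, Continuous f ∧ Function.Surjective f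
  have hQ : ∃ k ≤ M, Q k := by
    rcases isEmpty_or_nonempty X with hX | hX
    · exact ⟨0, M.zero_le, fun x => hX.elim x, continuous_of_const fun x => hX.elim x,
        fun i => i.elim0⟩
    · have h1 : Q 1 := ⟨fun _ => 0, continuous_const, fun i => ⟨hX.some, Subsingleton.elim _ _⟩⟩
      obtain ⟨f, hf, hs⟩ := h1
      exact ⟨1, hM 1 f hf hs, f, hf, hs⟩
  obtain ⟨k₀, hk₀, hQ₀⟩ := hQ
  obtain ⟨f, hf, hs⟩ : Q (Nat.findGreatest Q M) := Nat.findGreatest_spec hk₀ hQ₀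
  have hmax : ∀ k, Q k → k ≤ Nat.findGreatest Q M := fun k hk => by
    obtain ⟨f, hf, hs⟩ := id hk
    exact Nat.le_findGreatest (hM k f hf hs) hk
  have hkM : Nat.findGreatest Q M ≤ M := Nat.findGreatest_le M
  generalize Nat.findGreatest Q M = k at f hf hs hmax hkM
  have hpre : ∀ i, IsPreconnected (f ⁻¹' {i}) := by
    intro i
    by_contra hi
    rw [((isClopen_discrete {i}).preimage hf).not_isPreconnected_iff] at hi
    obtain ⟨a, b, ha, hb, ⟨x, hx⟩, ⟨y, hy⟩, hab, he⟩ := hi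
    have hfa : ∀ x ∈ a, f x = i := fun x hx => by
      have : x ∈ f ⁻¹' {i} := he ▸ Or.inl hx
      exact this
    have hfb : ∀ x ∈ b, f x = i := fun x hx => by
      have : x ∈ f ⁻¹' {i} := he ▸ Or.inr hx
      exact this
    have hQ' : Q (k + 1) := by
      refine ⟨fun x => if x ∈ b then Fin.last k else (f x).castSucc, ?_, fun j => ?_⟩
      · refine continuous_if ?_ continuousOn_const
          (continuous_of_discreteTopology.comp hf).continuousOn
        simp [hb.frontier_eq]
      · induction j using Fin.lastCases with
        | last => exact ⟨y, if_pos hy⟩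
        | cast j =>
          by_cases hj : j = i
          · refine ⟨x, ?_⟩
            simp [Set.disjoint_left.1 hab hx, hfa x hx, hj]
          · obtain ⟨w, hw⟩ := hs j
            refine ⟨w, ?_⟩
            simp [show w ∉ b from fun h => hj (hw ▸ hfb w h), hw]
    have := hmax _ hQ'
    omega
  have hinj : Function.Injective hf.connectedComponentsLift := by
    intro p q
    induction p using Quotient.inductionOn with | _ x
    induction q using Quotient.inductionOn with | _ y
    intro h
    have h' : f x = f y := h
    exact ConnectedComponents.coe_eq_coe'.2
      ((hpre (f y)).subset_connectedComponent (x := y) rfl h')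
  refine ⟨Finite.of_injective _ hinj, (Nat.card_le_card_of_injective _ hinj).trans ?_⟩
  simpa using hkM

open MvPolynomial in
/-- A real algebraic set which is the zero set of a nonnegative polynomial of degree at most
`2 * d` in `n` variables cannot be split into more than `(2 * d - 1) ^ n` clopen pieces. -/
theorem MvPolynomial.card_clopen_partition_zeros_le {σ : Type*} [Fintype σ] {d : ℕ} (hd : 1 ≤ d)
    (F : MvPolynomial σ ℝ) (hF : F.totalDegree ≤ 2 * d) (hF0 : ∀ x, 0 ≤ eval x F) {k : ℕ}
    (f : {x | eval x F = 0} → Fin k) (hf : Continuous f) (hs : Function.Surjective f) :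
    k ≤ (2 * d - 1) ^ Fintype.card σ := by
  by_contra! hk
  have hFc : Continuous fun x => eval x F := MvPolynomial.continuous_eval F
  have hZ : IsClosed {x | eval x F = 0} := isClosed_eq hFc continuous_const
  have hfc : Continuous fun x => ((f x : ℕ) : ℝ) :=
    (continuous_of_discreteTopology (f := fun i : Fin k => ((i : ℕ) : ℝ))).comp hf
  obtain ⟨g, hg⟩ := ContinuousMap.exists_restrict_eq hZ ⟨_, hfc⟩
  have hg' : ∀ x (hx : eval x F = 0), g x = ((f ⟨x, hx⟩ : ℕ) : ℝ) := fun x hx =>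
    DFunLike.congr_fun hg ⟨x, hx⟩
  have hd2 : (2 * d : ℝ) ≠ 0 := by positivity
  let h : (σ → ℝ) → ℝ := fun x => ∑ i, x i ^ (2 * d)
  have hnear : ∀ j : Fin k, ∃ δ > 0, ∀ ε, 0 < ε → ε < δ →
      ∃ x, |g x - (j : ℕ)| < 1 / 2 ∧ IsLocalMin (fun y => eval y F + ε * h y) x := by
    intro j
    obtain ⟨⟨z, hz⟩, hzj⟩ := hs j
    refine exists_isLocalMin_add_mul (u := fun x => |g x - (j : ℕ)|) hFc (by fun_prop)
      (by fun_prop) hF0 (fun x => Finset.sum_nonneg fun i _ => (even_two_mul d).pow_nonneg _)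
      (isCompact_setOf_sum_pow_le (even_two_mul d) (by omega)) hz ?_ fun x hx hx0 => ?_
    · simp [hg' z hz, hzj]
    · rw [hg' x hx0] at hx
      have h2 : |(2 * ((f ⟨x, hx0⟩ : ℕ) : ℤ) - 2 * ((j : ℕ) : ℤ) : ℤ)| = 1 := by
        have : |(2 * ((f ⟨x, hx0⟩ : ℕ) : ℝ) - 2 * ((j : ℕ) : ℝ))| = 1 := by
          rw [← mul_sub, abs_mul, hx]
          norm_num
        exact_mod_cast this
      rcases abs_cases (2 * ((f ⟨x, hx0⟩ : ℕ) : ℤ) - 2 * ((j : ℕ) : ℤ)) with h3 | h3 <;> omega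
  choose δ hδ hmin using hnear
  obtain ⟨δ₀, hδ₀, hδ₀le⟩ : ∃ δ₀ > 0, ∀ j, δ₀ ≤ δ j := by
    have : Nonempty (Fin k) := ⟨⟨0, by omega⟩⟩
    obtain ⟨j, hj⟩ := Finite.exists_min δ
    exact ⟨δ j, hδ j, hj⟩
  have hbad := finite_setOf_card_solutions_gt (fun i => C (2 * d : ℝ)⁻¹ * pderiv i F) (2 * d - 1)
    (fun i => (totalDegree_mul _ _).trans (by
      rw [totalDegree_C, zero_add]
      exact (totalDegree_pderiv_le i F).trans (Nat.sub_le_sub_right hF 1))) k hk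
  obtain ⟨ε, ⟨hε, hεδ⟩, hεbad⟩ := (Set.Ioo_infinite hδ₀).exists_notMem_finite hbad
  choose z hz hzmin using fun j => hmin j ε hε (hεδ.trans_le (hδ₀le j))
  refine hεbad ⟨z, fun i j hij => ?_, fun j i => ?_⟩
  · have h1 := hz i
    have h2 := hz j
    rw [← hij, abs_sub_lt_iff] at h2
    rw [abs_sub_lt_iff] at h1
    have h3 : ((i : ℕ) : ℝ) < (j : ℕ) + 1 := by linarith
    have h4 : ((j : ℕ) : ℝ) < (i : ℕ) + 1 := by linarith
    have h5 : (i : ℕ) < j + 1 := by exact_mod_cast h3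
    have h6 : (j : ℕ) < i + 1 := by exact_mod_cast h4
    omega
  · classical
    have hloc : IsLocalMin (fun y => eval y (F + C ε * ∑ i, X i ^ (2 * d))) (z j) := by
      simpa [h] using hzmin j
    have := eval_pderiv_eq_zero_of_isLocalMin hloc i
    simp only [map_add, pderiv_C_mul, map_sum, Derivation.leibniz_pow, pderiv_X, map_mul, eval_C,
      smul_eq_mul, nsmul_eq_mul, map_natCast, map_pow, eval_X, Pi.single_apply] at this
    simp only [apply_ite (eval (z j)), map_one, map_zero, mul_ite, mul_one, mul_zero,
      Finset.sum_ite_eq', Finset.mem_univ, if_true] at this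
    push_cast at this
    rw [map_mul, eval_C]
    field_simp
    linarith

open MvPolynomial in
/-- The preimage of an affine subspace under a polynomial map of degree at most `d` is the zero set
of a nonnegative polynomial of degree at most `2 * d`. -/
theorem exists_nonneg_polynomial_zeros_eq_preimage {n N d : ℕ}
    (P : Fin N → MvPolynomial (Fin n) ℝ) (hdeg : ∀ i, (P i).totalDegree ≤ d)
    (L : AffineSubspace ℝ (EuclideanSpace ℝ (Fin N)))
    (hL : (L : Set (EuclideanSpace ℝ (Fin N))).Nonempty) :
    ∃ F : MvPolynomial (Fin n) ℝ, F.totalDegree ≤ 2 * d ∧ (∀ x, 0 ≤ eval x F) ∧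
      ∀ x, eval x F = 0 ↔ polyMap P x ∈ L := by
  obtain ⟨c, hc⟩ := hL
  let b := stdOrthonormalBasis ℝ L.directionᗮ
  let Q := fun j => ∑ i, C ((b j : EuclideanSpace ℝ (Fin N)) i) * (P i - C (c i))
  have hQ : ∀ x j, eval x (Q j) = inner ℝ (b j : EuclideanSpace ℝ (Fin N)) (polyMap P x - c) := by
    intro x j
    simp [Q, PiLp.inner_apply, polyMap, mul_comm]
  have hQdeg : ∀ j, (Q j).totalDegree ≤ d := fun j => totalDegree_finsetSum_le fun i _ =>
    (totalDegree_mul _ _).trans (by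
      rw [totalDegree_C, zero_add]
      exact (totalDegree_sub_C_le _ _).trans (hdeg i))
  refine ⟨∑ j, Q j ^ 2, totalDegree_finsetSum_le fun j _ => (totalDegree_pow _ _).trans
    (Nat.mul_le_mul_left 2 (hQdeg j)), fun x => ?_, fun x => ?_⟩
  · simp only [map_sum, map_pow]
    positivity
  · have hmem : polyMap P x - c ∈ L.direction ↔ polyMap P x - c ∈ L.directionᗮᗮ := by
      rw [Submodule.orthogonal_orthogonal]
    rw [← AffineSubspace.vsub_right_mem_direction_iff_mem hc, vsub_eq_sub, hmem,
      Submodule.mem_orthogonal]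
    simp only [map_sum, map_pow, Finset.sum_eq_zero_iff_of_nonneg (fun _ _ => sq_nonneg _),
      Finset.mem_univ, forall_true_left, pow_eq_zero_iff two_ne_zero, hQ]
    refine ⟨fun h u hu => ?_, fun h j => h _ (b j).2⟩
    have hsum := congrArg Subtype.val (b.sum_repr ⟨u, hu⟩)
    rw [Submodule.coe_sum, Subtype.coe_mk] at hsum
    rw [← hsum, sum_inner]
    refine Finset.sum_eq_zero fun j _ => ?_
    rw [Submodule.coe_smul, real_inner_smul_left, h j, mul_zero]

/-- The intersection of the image of a polynomial map of degree at most `d`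
with any affine subspace has at most `(2d)^n` connected components. -/
theorem image_polyMap_inter_affine_components (n N d : ℕ)
    (hn : 1 ≤ n) (hN : 1 ≤ N) (hd : 1 ≤ d)
    (P : Fin N → MvPolynomial (Fin n) ℝ) (hdeg : ∀ i, (P i).totalDegree ≤ d)
    (L : AffineSubspace ℝ (EuclideanSpace ℝ (Fin N)))
    (hL : (L : Set (EuclideanSpace ℝ (Fin N))).Nonempty) :
    Finite (ConnectedComponents
      ↥(Set.range (polyMap P) ∩ (L : Set (EuclideanSpace ℝ (Fin N))))) ∧
    Nat.card (ConnectedComponents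
      ↥(Set.range (polyMap P) ∩ (L : Set (EuclideanSpace ℝ (Fin N)))))
      ≤ (2 * d) ^ n := by
  refine card_connectedComponents_le _ fun k f hf hs => ?_
  obtain ⟨F, hF, hF0, hFL⟩ := exists_nonneg_polynomial_zeros_eq_preimage P hdeg L hL
  have hp : Continuous (polyMap P) :=
    (PiLp.continuous_toLp 2 _).comp (continuous_pi fun i => MvPolynomial.continuous_eval (P i))
  let q : {x | MvPolynomial.eval x F = 0} →
      ↥(Set.range (polyMap P) ∩ (L : Set (EuclideanSpace ℝ (Fin N)))) :=
    fun x => ⟨polyMap P x, ⟨x, rfl⟩, (hFL x).1 x.2⟩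
  have hq : Continuous q := (hp.comp continuous_subtype_val).subtype_mk _
  have hqs : Function.Surjective q := by
    rintro ⟨_, ⟨x, rfl⟩, hx⟩
    exact ⟨⟨x, (hFL x).2 hx⟩, rfl⟩
  have := F.card_clopen_partition_zeros_le hd hF hF0 (f ∘ q) (hf.comp hq) (hs.comp hqs)
  rw [Fintype.card_fin] at this
  exact this.trans (Nat.pow_le_pow_left (Nat.sub_le _ _) n)
end

section
/- Let n, N ≥ 1 and d ≥ 1 be integers, c > 0, and let p : ℝ^n → ℝ^N be a polynomial map of degree at most d. Set V = im(p) ∩ {x ∈ ℝ^N : ‖x‖ ≤ c}. Then for every ε with 0 < ε ≤ diam(V), the Lebesgue measure of the tubular neighborhood 𝕋(V, ε) = {y ∈ ℝ^N : there exists v ∈ V with ‖y − v‖ ≤ ε} satisfies vol(𝕋(V, ε)) ≤ 2·(4d)^{n+1}·(2·c·n·N^{3/2}/ε)^n·(2ε)^N·vol(𝔹^N), where vol(𝔹^N) denotes the Lebesgue measure of the closed unit ball of ℝ^N. -/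
open MeasureTheory

namespace MvPolynomial

theorem totalDegree_pderiv_le_s7 {σ R : Type*} [CommSemiring R] (i : σ) (p : MvPolynomial σ R) :
    (pderiv i p).totalDegree ≤ p.totalDegree := by
  classical
  refine Finset.sup_le fun m hm => ?_
  have hm' : m + Finsupp.single i 1 ∈ p.support := by
    rw [mem_support_iff] at hm ⊢
    rw [coeff_pderiv] at hm
    exact left_ne_zero_of_mul hm
  refine le_trans ?_ (le_totalDegree hm')
  rw [Finsupp.sum_add_index' (by simp) (by simp)]
  exact Nat.le_add_right _ _

/-- Finitely many points can be interpolated by polynomials over a field. -/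
theorem exists_eval_eq_pi_single {σ K : Type*} [Field K] [DecidableEq (σ → K)]
    (S : Finset (σ → K)) (x : S) :
    ∃ p : MvPolynomial σ K, (fun y : S => eval (y : σ → K) p) = Pi.single x 1 := by
  have hsep : ∀ y : S, ∃ p : MvPolynomial σ K,
      eval (x : σ → K) p = 1 ∧ (y ≠ x → eval (y : σ → K) p = 0) := by
    intro y
    by_cases hxy : y = x
    · exact ⟨1, by simp, fun h => absurd hxy h⟩
    · obtain ⟨i, hi⟩ : ∃ i, (y : σ → K) i ≠ (x : σ → K) i := by
        by_contra! h
        exact hxy (Subtype.ext (_root_.funext h))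
      refine ⟨C ((x : σ → K) i - (y : σ → K) i)⁻¹ * (X i - C ((y : σ → K) i)), ?_, fun _ => ?_⟩
      · have : (x : σ → K) i - (y : σ → K) i ≠ 0 := sub_ne_zero.mpr hi.symm
        simp [this]
      · simp
  choose q hq using hsep
  refine ⟨∏ y, q y, _root_.funext fun y => ?_⟩
  rw [eval_prod]
  by_cases hxy : y = x
  · subst hxy
    simp [fun z => (hq z).1]
  · rw [Pi.single_eq_of_ne hxy]
    exact Finset.prod_eq_zero (Finset.mem_univ y) ((hq y).2 hxy)

/-- If `x i ^ M = r i (x)` with `deg (r i) < M` on `S`, then on `S` every polynomial agrees with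
a polynomial whose exponents are all less than `M`. -/
theorem eval_mem_span_of_pow_eq {n M : ℕ} {K : Type*} [Field K] (S : Finset (Fin n → K))
    (r : Fin n → MvPolynomial (Fin n) K) (hr : ∀ i, (r i).totalDegree < M)
    (hS : ∀ x ∈ S, ∀ i, x i ^ M = eval x (r i)) (p : MvPolynomial (Fin n) K) :
    (fun x : S => eval (x : Fin n → K) p) ∈ Submodule.span K
      (Set.range fun (a : Fin n → Fin M) (x : S) => ∏ i, (x : Fin n → K) i ^ (a i : ℕ)) := by
  suffices H : ∀ (k : ℕ) (p : MvPolynomial (Fin n) K), p.totalDegree < k →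
      (fun x : S => eval (x : Fin n → K) p) ∈ Submodule.span K
      (Set.range fun (a : Fin n → Fin M) (x : S) => ∏ i, (x : Fin n → K) i ^ (a i : ℕ)) from
    H _ p (Nat.lt_succ_self _)
  intro k
  induction k with
  | zero => intro p hp; omega
  | succ k ih =>
    intro p hp
    have hsum : (fun x : S => eval (x : Fin n → K) p) =
        ∑ m ∈ p.support, coeff m p • fun x : S => ∏ i, (x : Fin n → K) i ^ m i := by
      ext x
      simp [eval_eq']
    rw [hsum]
    refine Submodule.sum_mem _ fun m hm => Submodule.smul_mem _ _ ?_
    have hmk : (m.sum fun _ e => e) ≤ k := (le_totalDegree hm).trans (Nat.lt_succ_iff.mp hp)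
    by_cases hmM : ∀ i, m i < M
    · exact Submodule.subset_span ⟨fun i => ⟨m i, hmM i⟩, rfl⟩
    · push Not at hmM
      obtain ⟨i, hi⟩ := hmM
      have hle : Finsupp.single i M ≤ m := by simpa using hi
      have hsplit := tsub_add_cancel_of_le hle
      set m' := m - Finsupp.single i M
      have heq : (fun x : S => ∏ j, (x : Fin n → K) j ^ m j) =
          fun x : S => eval (x : Fin n → K) (monomial m' 1 * r i) := by
        ext x
        have hone : ∏ j, (x : Fin n → K) j ^ Finsupp.single i M j = (x : Fin n → K) i ^ M := by
          rw [Finset.prod_eq_single i (fun j _ hj => by simp [hj.symm]) (by simp)]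
          simp
        rw [eval_mul, ← hS x x.2 i, eval_monomial, one_mul, ← hsplit, ← hone,
          Finsupp.prod_fintype _ _ (by simp), ← Finset.prod_mul_distrib]
        simp [pow_add]
      rw [heq]
      refine ih _ ((totalDegree_mul _ _).trans_lt ?_)
      rw [totalDegree_monomial _ one_ne_zero]
      rw [← hsplit, Finsupp.sum_add_index' (by simp) (by simp), Finsupp.sum_single_index rfl] at hmk
      have := hr i
      omega

/-- A Bézout-type bound: a system `x i ^ M = r i (x)` with `deg (r i) < M` has at most `M ^ n`
solutions. -/
theorem card_le_of_pow_eq {n M : ℕ} {K : Type*} [Field K] (S : Finset (Fin n → K))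
    (r : Fin n → MvPolynomial (Fin n) K) (hr : ∀ i, (r i).totalDegree < M)
    (hS : ∀ x ∈ S, ∀ i, x i ^ M = eval x (r i)) : S.card ≤ M ^ n := by
  classical
  have htop : Submodule.span K
      (Set.range fun (a : Fin n → Fin M) (x : S) => ∏ i, (x : Fin n → K) i ^ (a i : ℕ)) = ⊤ := by
    rw [eq_top_iff, ← (Pi.basisFun K S).span_eq, Submodule.span_le]
    rintro _ ⟨x, rfl⟩
    obtain ⟨p, hp⟩ := exists_eval_eq_pi_single S x
    rw [Pi.basisFun_apply, ← hp]
    exact eval_mem_span_of_pow_eq S r hr hS p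
  have hrank := finrank_range_le_card (R := K)
    fun (a : Fin n → Fin M) (x : S) => ∏ i, (x : Fin n → K) i ^ (a i : ℕ)
  rw [Set.finrank, htop, finrank_top] at hrank
  simpa using hrank

theorem hasDerivAt_eval_update_s7 {σ : Type*} [DecidableEq σ] (p : MvPolynomial σ ℝ) (x : σ → ℝ)
    (i : σ) : HasDerivAt (fun t => eval (Function.update x i t) p) (eval x (pderiv i p)) (x i) := by
  induction p using MvPolynomial.induction_on with
  | C a => simpa using hasDerivAt_const (x i) a
  | add p q hp hq =>
    simp only [map_add]
    exact hp.fun_add hq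
  | mul_X p j hp =>
    have hX : HasDerivAt (fun t => Function.update x i t j) (eval x (pderiv i (X j))) (x i) := by
      by_cases h : j = i
      · subst h
        simpa using hasDerivAt_id' (x j)
      · simpa [h, pderiv_X] using hasDerivAt_const (x i) (x j)
    have hmul := hp.fun_mul hX
    rw [Function.update_eq_self] at hmul
    simp only [eval_mul, eval_X, pderiv_mul, eval_add]
    exact hmul

theorem pderiv_eval_eq_zero_of_isLocalMax {σ : Type*} (p : MvPolynomial σ ℝ) {x : σ → ℝ}
    (hx : IsLocalMax (fun y => eval y p) x) (i : σ) : eval x (pderiv i p) = 0 := by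
  classical
  have hc : ContinuousAt (fun t => Function.update x i t) (x i) :=
    (continuous_const.update i continuous_id).continuousAt
  have hmax : IsLocalMax (fun t => eval (Function.update x i t) p) (x i) := by
    have hx' : IsLocalMax (fun y => eval y p) (Function.update x i (x i)) := by
      rwa [Function.update_eq_self]
    exact hx'.comp_continuous hc
  exact hmax.hasDerivAt_eq_zero (hasDerivAt_eval_update_s7 p x i)

/-- Polynomial growth with respect to the sup norm. -/
theorem exists_abs_eval_le {n : ℕ} (p : MvPolynomial (Fin n) ℝ) :
    ∃ A : ℝ, ∀ x : Fin n → ℝ, 1 ≤ ‖x‖ → |eval x p| ≤ A * ‖x‖ ^ p.totalDegree := by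
  refine ⟨∑ m ∈ p.support, |coeff m p|, fun x hx => ?_⟩
  rw [eval_eq', Finset.sum_mul]
  refine (Finset.abs_sum_le_sum_abs _ _).trans (Finset.sum_le_sum fun m hm => ?_)
  rw [abs_mul, Finset.abs_prod]
  refine mul_le_mul_of_nonneg_left ?_ (abs_nonneg _)
  calc ∏ i, |x i ^ m i| ≤ ∏ i, ‖x‖ ^ m i := by
        refine Finset.prod_le_prod (fun _ _ => abs_nonneg _) fun i _ => ?_
        rw [abs_pow]
        exact pow_le_pow_left₀ (abs_nonneg _) (norm_le_pi_norm x i) _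
    _ = ‖x‖ ^ (m.sum fun _ e => e) := by
        rw [Finset.prod_pow_eq_pow_sum, Finsupp.sum_fintype _ _ (by simp)]
    _ ≤ ‖x‖ ^ p.totalDegree := pow_le_pow_right₀ hx (le_totalDegree hm)

theorem norm_pow_le_sum_pow {n : ℕ} [Nonempty (Fin n)] (x : Fin n → ℝ) (m : ℕ) :
    ‖x‖ ^ (2 * m) ≤ ∑ i, x i ^ (2 * m) := by
  obtain ⟨i, hi⟩ := Finite.exists_max fun i => ‖x i‖
  have hx : ‖x‖ ≤ ‖x i‖ := (pi_norm_le_iff_of_nonneg (norm_nonneg _)).mpr hi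
  calc ‖x‖ ^ (2 * m) ≤ ‖x i‖ ^ (2 * m) := pow_le_pow_left₀ (norm_nonneg _) hx _
    _ = x i ^ (2 * m) := (even_two_mul m).pow_abs _
    _ ≤ ∑ i, x i ^ (2 * m) :=
        Finset.single_le_sum (f := fun i => x i ^ (2 * m))
          (fun j _ => (even_two_mul m).pow_nonneg _) (Finset.mem_univ i)

theorem eventually_eval_le_mul_sum_pow {n m : ℕ} (hn : 1 ≤ n) (p : MvPolynomial (Fin n) ℝ)
    (hp : p.totalDegree < 2 * m) {l : ℝ} (hl : 0 < l) :
    ∀ᶠ x : Fin n → ℝ in Filter.cocompact _, eval x p ≤ l * ∑ i, x i ^ (2 * m) := by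
  have : Nonempty (Fin n) := ⟨⟨0, hn⟩⟩
  obtain ⟨A, hA⟩ := exists_abs_eval_le p
  have htend := tendsto_norm_cocompact_atTop (E := Fin n → ℝ)
  filter_upwards [htend.eventually_ge_atTop 1, htend.eventually_ge_atTop (A / l)] with x h1 h2
  rw [div_le_iff₀' hl] at h2
  calc eval x p ≤ A * ‖x‖ ^ p.totalDegree := (le_abs_self _).trans (hA x h1)
    _ ≤ l * ‖x‖ * ‖x‖ ^ p.totalDegree := by gcongr
    _ = l * ‖x‖ ^ (p.totalDegree + 1) := by ring
    _ ≤ l * ‖x‖ ^ (2 * m) := by gcongr; exact hp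
    _ ≤ l * ∑ i, x i ^ (2 * m) := by gcongr; exact norm_pow_le_sum_pow x m

/-- In the sign cell of `x₀` there is a critical point of `(∏ j, f j) ^ 2 - l ∑ i, x i ^ (2m)`,
provided this function is positive at `x₀`. -/
theorem exists_critical_point_sameSign {n m : ℕ} (hn : 1 ≤ n) {ι : Type*} [Fintype ι]
    (f : ι → MvPolynomial (Fin n) ℝ) (hdeg : ((∏ j, f j) ^ 2).totalDegree < 2 * m)
    {l : ℝ} (hl : 0 < l) (x₀ : Fin n → ℝ)
    (hx₀ : l * ∑ i, x₀ i ^ (2 * m) < eval x₀ ((∏ j, f j) ^ 2)) :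
    ∃ z : Fin n → ℝ, (∀ j, 0 < eval x₀ (f j) * eval z (f j)) ∧
      ∀ i, eval z (pderiv i ((∏ j, f j) ^ 2)) = l * (2 * m * z i ^ (2 * m - 1)) := by
  classical
  set g := (∏ j, f j) ^ 2 with hg
  set h : MvPolynomial (Fin n) ℝ := g - C l * ∑ i, X i ^ (2 * m) with hh
  have heval : ∀ x, eval x h = eval x g - l * ∑ i, x i ^ (2 * m) := fun x => by simp [hh]
  have hpos : ∀ x : Fin n → ℝ, 0 ≤ l * ∑ i, x i ^ (2 * m) := fun x =>
    mul_nonneg hl.le (Finset.sum_nonneg fun i _ => (even_two_mul m).pow_nonneg _)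
  have hne : ∀ x, 0 < eval x g → ∀ j, eval x (f j) ≠ 0 := by
    intro x hx j hj
    rw [hg, map_pow, eval_prod, Finset.prod_eq_zero (Finset.mem_univ j) hj] at hx
    simp at hx
  have hcont : ∀ j, Continuous fun x => eval x₀ (f j) * eval x (f j) := fun j =>
    continuous_const.mul (continuous_eval (f j))
  set c : Set (Fin n → ℝ) := {x | ∀ j, 0 ≤ eval x₀ (f j) * eval x (f j)} with hc
  have hclosed : IsClosed c := by
    rw [hc, Set.ofPred_forall]
    exact isClosed_iInter fun j => isClosed_le continuous_const (hcont j)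
  have hev : ∀ᶠ x in Filter.cocompact _ ⊓ Filter.principal c, eval x h ≤ eval x₀ h := by
    refine Filter.Eventually.filter_mono inf_le_left ?_
    filter_upwards [eventually_eval_le_mul_sum_pow hn g hdeg hl] with x hx
    rw [heval, heval]
    linarith
  obtain ⟨z, hzc, hz⟩ := (continuous_eval h).continuousOn.exists_isMaxOn' hclosed
    (fun j => mul_self_nonneg _ : x₀ ∈ c) hev
  have hzx : eval x₀ h ≤ eval z h := hz (fun j => mul_self_nonneg _ : x₀ ∈ c)
  rw [heval, heval] at hzx
  have hgz : 0 < eval z g := by linarith [hpos z]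
  have hgx : 0 < eval x₀ g := by linarith [hpos x₀]
  have hzs : ∀ j, 0 < eval x₀ (f j) * eval z (f j) := fun j =>
    (hzc j).lt_of_ne' (mul_ne_zero (hne _ hgx j) (hne _ hgz j))
  have hnhds : c ∈ nhds z := by
    filter_upwards [Filter.eventually_all.mpr fun j =>
      (hcont j).continuousAt.eventually_const_lt (hzs j)] with x hx j using (hx j).le
  refine ⟨z, hzs, fun i => ?_⟩
  have hcrit := pderiv_eval_eq_zero_of_isLocalMax h (hz.isLocalMax hnhds) i
  rw [hh, map_sub, map_sub, sub_eq_zero] at hcrit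
  rw [hcrit, pderiv_C_mul, eval_mul, eval_C, map_sum, map_sum,
    Finset.sum_eq_single i (fun j _ hj => by simp [pderiv_X, hj]) (by simp)]
  simp

/-- Bound on the number of strict sign patterns. -/
theorem card_le_of_sign_ne {n D : ℕ} (hn : 1 ≤ n) {ι : Type*} [Fintype ι]
    (f : ι → MvPolynomial (Fin n) ℝ) (hdeg : (∏ j, f j).totalDegree ≤ D)
    (S : Finset (Fin n → ℝ)) (hne : ∀ x ∈ S, ∀ j, eval x (f j) ≠ 0)
    (hS : ∀ x ∈ S, ∀ y ∈ S, x ≠ y → ∃ j, eval x (f j) * eval y (f j) < 0) :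
    S.card ≤ (2 * D + 1) ^ n := by
  classical
  set g := (∏ j, f j) ^ 2 with hg
  have hgdeg : g.totalDegree ≤ 2 * D :=
    (totalDegree_pow _ _).trans (Nat.mul_le_mul_left 2 hdeg)
  have hgpos : ∀ x ∈ S, 0 < eval x g := by
    intro x hx
    have : eval x (∏ j, f j) ≠ 0 := by
      rw [eval_prod]
      exact Finset.prod_ne_zero_iff.mpr fun j _ => hne x hx j
    rw [hg, map_pow]
    positivity
  obtain ⟨l, hlS, hl⟩ : ∃ l : ℝ,
      (∀ x ∈ S, l * ∑ i, x i ^ (2 * (D + 1)) < eval x g) ∧ 0 < l := by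
    have hev : ∀ᶠ l : ℝ in nhdsWithin 0 (Set.Ioi 0),
        ∀ x ∈ S, l * ∑ i, x i ^ (2 * (D + 1)) < eval x g := by
      rw [Filter.eventually_all_finset]
      intro x hx
      refine Filter.Eventually.filter_mono nhdsWithin_le_nhds ?_
      have hc : Continuous fun l : ℝ => l * ∑ i, x i ^ (2 * (D + 1)) := by fun_prop
      exact hc.continuousAt.eventually_lt_const (by simpa using hgpos x hx)
    exact (hev.and self_mem_nhdsWithin).exists
  have hcrit : ∀ x : S, ∃ z : Fin n → ℝ, (∀ j, 0 < eval (x : Fin n → ℝ) (f j) * eval z (f j)) ∧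
      ∀ i, eval z (pderiv i g) = l * (2 * (D + 1 : ℕ) * z i ^ (2 * (D + 1) - 1)) := fun x =>
    exists_critical_point_sameSign hn f (hgdeg.trans_lt (by omega)) hl x (hlS x x.2)
  choose z hzsign hz using hcrit
  have hinj : Function.Injective z := by
    intro x y hxy
    by_contra hne'
    obtain ⟨j, hj⟩ := hS x x.2 y y.2 fun h => hne' (Subtype.ext h)
    have h1 := hzsign x j
    have h2 := hzsign y j
    rw [hxy] at h1
    nlinarith [mul_pos h1 h2, mul_self_nonneg (eval (z y) (f j))]
  have hcard : S.card = (Finset.univ.image z).card := by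
    rw [Finset.card_image_of_injective _ hinj, Finset.card_univ, Fintype.card_coe]
  rw [hcard]
  refine card_le_of_pow_eq _ (fun i => C (l * (2 * (D + 1 : ℕ)))⁻¹ * pderiv i g) (fun i => ?_) ?_
  · refine (totalDegree_mul _ _).trans_lt ?_
    rw [totalDegree_C, zero_add]
    exact (totalDegree_pderiv_le_s7 i g).trans_lt (by omega)
  · intro y hy i
    obtain ⟨x, -, rfl⟩ := Finset.mem_image.mp hy
    rw [eval_mul, eval_C, hz, show 2 * (D + 1) - 1 = 2 * D + 1 by omega]
    have : (0 : ℝ) < (D + 1 : ℕ) := by positivity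
    field_simp

/-- Bound on the number of patterns `(0 ≤ f j)_j`. -/
theorem card_le_of_nonneg_pattern_ne {n d : ℕ} (hn : 1 ≤ n) {ι : Type*} [Fintype ι]
    (f : ι → MvPolynomial (Fin n) ℝ) (hdeg : ∀ j, (f j).totalDegree ≤ d)
    (S : Finset (Fin n → ℝ))
    (hS : ∀ x ∈ S, ∀ y ∈ S, (∀ j, 0 ≤ eval x (f j) ↔ 0 ≤ eval y (f j)) → x = y) :
    S.card ≤ (2 * (Fintype.card ι * d) + 1) ^ n := by
  obtain ⟨η, hηS, hη⟩ : ∃ η : ℝ,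
      (∀ x ∈ S, ∀ j, eval x (f j) < 0 → eval x (f j) + η < 0) ∧ 0 < η := by
    have hev : ∀ᶠ η : ℝ in nhdsWithin 0 (Set.Ioi 0),
        ∀ x ∈ S, ∀ j, eval x (f j) < 0 → eval x (f j) + η < 0 := by
      rw [Filter.eventually_all_finset]
      refine fun x _ => Filter.eventually_all.mpr fun j => ?_
      refine Filter.Eventually.filter_mono nhdsWithin_le_nhds ?_
      by_cases hneg : eval x (f j) < 0
      · have hc : Continuous fun η : ℝ => eval x (f j) + η := by fun_prop
        filter_upwards [hc.continuousAt.eventually_lt_const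
          (by simpa using hneg : eval x (f j) + 0 < 0)] with η h _ using h
      · exact Filter.Eventually.of_forall fun _ h => absurd h hneg
    exact (hev.and self_mem_nhdsWithin).exists
  have hprod : (∏ j, (f j + C η)).totalDegree ≤ Fintype.card ι * d := by
    refine (totalDegree_finsetProd _ _).trans ?_
    refine (Finset.sum_le_card_nsmul _ _ d fun j _ => ?_).trans (by simp)
    exact (totalDegree_add _ _).trans (by simpa using hdeg j)
  refine card_le_of_sign_ne hn (fun j => f j + C η) hprod S (fun x hx j => ?_)
    fun x hx y hy hxy => ?_
  · rw [eval_add, eval_C]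
    rcases lt_or_ge (eval x (f j)) 0 with h | h
    · exact (hηS x hx j h).ne
    · positivity
  · by_contra! hall
    refine hxy (hS x hx y hy fun j => ?_)
    have hj := hall j
    simp only [eval_add, eval_C] at hj
    rcases lt_or_ge (eval x (f j)) 0 with h | h <;> rcases lt_or_ge (eval y (f j)) 0 with h' | h'
    · simp [h.not_ge, h'.not_ge]
    · have := hηS x hx j h
      nlinarith
    · have := hηS y hy j h'
      nlinarith
    · simp [h, h']

end MvPolynomial

theorem abs_sub_lt_one_of_forall_succ_le_iff {K : ℕ} {u v : ℝ} (hu : 0 ≤ u) (hv : 0 ≤ v)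
    (huK : ⌊u⌋₊ ≤ K) (hvK : ⌊v⌋₊ ≤ K)
    (h : ∀ k : Fin K, ((k : ℕ) + 1 : ℝ) ≤ u ↔ ((k : ℕ) + 1 : ℝ) ≤ v) : |u - v| < 1 := by
  have hle : ∀ {a b : ℝ}, ⌊b⌋₊ ≤ K →
      (∀ k : Fin K, ((k : ℕ) + 1 : ℝ) ≤ b → ((k : ℕ) + 1 : ℝ) ≤ a) → b < ⌊a⌋₊ + 1 := by
    intro a b hbK hab
    by_contra! hlt
    have hfl : ⌊a⌋₊ + 1 ≤ ⌊b⌋₊ := Nat.le_floor (by exact_mod_cast hlt)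
    exact (Nat.lt_floor_add_one a).not_ge (hab ⟨⌊a⌋₊, by omega⟩ hlt)
  have h1 := hle hvK fun k => (h k).mpr
  have h2 := hle huK fun k => (h k).mp
  rw [abs_lt]
  constructor <;> linarith [Nat.floor_le hu, Nat.floor_le hv]

/-- The image of a polynomial map, cut with a ball, is covered by few balls of radius `ε`. -/
theorem exists_cover_range_polyMap {n N d : ℕ} (hn : 1 ≤ n) (hN : 1 ≤ N) {c : ℝ}
    (P : Fin N → MvPolynomial (Fin n) ℝ) (hdeg : ∀ i, (P i).totalDegree ≤ d)
    {ε : ℝ} (hε : 0 < ε) :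
    ∃ S : Finset (Fin n → ℝ),
      S.card ≤ (2 * (N * ⌊2 * c * √N / ε⌋₊ * d) + 1) ^ n ∧
      ∀ v ∈ Set.range (polyMap P) ∩ Metric.closedBall (0 : EuclideanSpace ℝ (Fin N)) c,
        ∃ x ∈ S, dist v (polyMap P x) ≤ ε := by
  classical
  set K := ⌊2 * c * √N / ε⌋₊ with hK
  have hN' : 0 < √(N : ℝ) := Real.sqrt_pos.mpr (by exact_mod_cast hN)
  set δ := ε / √N with hδ
  have hδpos : 0 < δ := by positivity
  set f : Fin N × Fin K → MvPolynomial (Fin n) ℝ :=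
    fun j => P j.1 + MvPolynomial.C (c - ((j.2 : ℕ) + 1) * δ) with hf
  set T : Set (Fin n → ℝ) := {x | polyMap P x ∈ Metric.closedBall 0 c} with hT
  have hcoord : ∀ x ∈ T, ∀ i, |MvPolynomial.eval x (P i)| ≤ c := by
    intro x hx i
    have hx' : ‖polyMap P x‖ ≤ c := mem_closedBall_zero_iff.mp hx
    exact (PiLp.norm_apply_le (polyMap P x) i).trans hx'
  obtain ⟨S, hST, hbij⟩ := (Set.surjOn_image
    (fun (x : Fin n → ℝ) (j : Fin N × Fin K) => 0 ≤ MvPolynomial.eval x (f j)) T).exists_bijOn_subset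
  have hfin : S.Finite := Set.Finite.of_finite_image (Set.toFinite _) hbij.injOn
  refine ⟨hfin.toFinset, ?_, ?_⟩
  · have hcard := MvPolynomial.card_le_of_nonneg_pattern_ne (d := d) hn f (fun j => ?_)
      hfin.toFinset fun x hx y hy hxy => ?_
    · simpa using hcard
    · exact (MvPolynomial.totalDegree_add _ _).trans
        (max_le (hdeg j.1) ((MvPolynomial.totalDegree_C _).trans_le (Nat.zero_le d)))
    · exact hbij.injOn (hfin.mem_toFinset.mp hx) (hfin.mem_toFinset.mp hy)
        (funext fun j => propext (hxy j))
  · rintro _ ⟨⟨y, rfl⟩, hy⟩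
    obtain ⟨x, hxS, hxy⟩ := hbij.surjOn ⟨y, hy, rfl⟩
    refine ⟨x, hfin.mem_toFinset.mpr hxS, ?_⟩
    have hclose : ∀ i, |MvPolynomial.eval y (P i) - MvPolynomial.eval x (P i)| ≤ δ := by
      intro i
      have hbd : ∀ w ∈ T, 0 ≤ (MvPolynomial.eval w (P i) + c) / δ ∧
          ⌊(MvPolynomial.eval w (P i) + c) / δ⌋₊ ≤ K := by
        intro w hw
        have := abs_le.mp (hcoord w hw i)
        refine ⟨div_nonneg (by linarith) hδpos.le, Nat.floor_le_floor ?_⟩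
        rw [hδ, div_div_eq_mul_div]
        gcongr
        linarith
      have hlt := abs_sub_lt_one_of_forall_succ_le_iff (hbd y hy).1 (hbd x (hST hxS)).1
        (hbd y hy).2 (hbd x (hST hxS)).2 fun k => by
          have hk := congrFun hxy (i, k)
          simp only [hf, MvPolynomial.eval_add, MvPolynomial.eval_C, eq_iff_iff] at hk
          rw [le_div_iff₀ hδpos, le_div_iff₀ hδpos]
          constructor <;> intro h
          · linarith [hk.mpr (by linarith)]
          · linarith [hk.mp (by linarith)]
      rw [← sub_div, abs_div, abs_of_pos hδpos, div_lt_one hδpos, add_sub_add_right_eq_sub] at hlt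
      exact hlt.le
    rw [EuclideanSpace.dist_eq]
    refine Real.sqrt_le_iff.mpr ⟨hε.le, ?_⟩
    calc ∑ i, dist (polyMap P y i) (polyMap P x i) ^ 2 ≤ ∑ _i : Fin N, δ ^ 2 :=
          Finset.sum_le_sum fun i _ => pow_le_pow_left₀ dist_nonneg (hclose i) 2
      _ = ε ^ 2 := by
          rw [Finset.sum_const, Finset.card_univ, Fintype.card_fin, nsmul_eq_mul, hδ, div_pow,
            Real.sq_sqrt (Nat.cast_nonneg _)]
          have : (N : ℝ) ≠ 0 := by positivity
          field_simp

/-- Volume bound for the `ε`-tubular neighborhood of the image of a polynomial map of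
degree at most `d` intersected with the closed ball of radius `c`:
`vol(𝕋(V, ε)) ≤ 2·(4d)^(n+1)·(2cnN^{3/2}/ε)^n·(2ε)^N·vol(𝔹^N)`. -/
theorem tube_volume_image_polyMap (n N d : ℕ)
    (hn : 1 ≤ n) (hN : 1 ≤ N) (hd : 1 ≤ d) (c : ℝ) (hc : 0 < c)
    (P : Fin N → MvPolynomial (Fin n) ℝ) (hdeg : ∀ i, (P i).totalDegree ≤ d)
    (ε : ℝ) (hε : 0 < ε)
    (hεd : ε ≤ Metric.diam
      (Set.range (polyMap P) ∩ Metric.closedBall (0 : EuclideanSpace ℝ (Fin N)) c)) :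
    volume {y : EuclideanSpace ℝ (Fin N) |
        ∃ v ∈ Set.range (polyMap P) ∩ Metric.closedBall (0 : EuclideanSpace ℝ (Fin N)) c,
          dist y v ≤ ε}
      ≤ ENNReal.ofReal (2 * (4 * d) ^ (n + 1)
            * (2 * c * n * (N : ℝ) ^ ((3 : ℝ) / 2) / ε) ^ n * (2 * ε) ^ N)
        * volume (Metric.closedBall (0 : EuclideanSpace ℝ (Fin N)) 1) := by
  set V := Set.range (polyMap P) ∩ Metric.closedBall (0 : EuclideanSpace ℝ (Fin N)) c with hV
  have hε2c : ε ≤ 2 * c := hεd.trans ((Metric.diam_mono Set.inter_subset_right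
    Metric.isBounded_closedBall).trans (Metric.diam_closedBall hc.le))
  obtain ⟨S, hcard, hcover⟩ := exists_cover_range_polyMap (c := c) hn hN P hdeg hε
  have hsub : {y : EuclideanSpace ℝ (Fin N) | ∃ v ∈ V, dist y v ≤ ε} ⊆
      ⋃ x ∈ S, Metric.closedBall (polyMap P x) (2 * ε) := by
    rintro y ⟨v, hv, hyv⟩
    obtain ⟨x, hx, hvx⟩ := hcover v hv
    refine Set.mem_iUnion₂.mpr ⟨x, hx, Metric.mem_closedBall.mpr ?_⟩
    linarith [dist_triangle y v (polyMap P x)]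
  have hcount : (S.card : ℝ) ≤
      2 * (4 * d) ^ (n + 1) * (2 * c * n * (N : ℝ) ^ ((3 : ℝ) / 2) / ε) ^ n := by
    have hN1 : (1 : ℝ) ≤ N := by exact_mod_cast hN
    have hn1 : (1 : ℝ) ≤ n := by exact_mod_cast hn
    have hd1 : (1 : ℝ) ≤ d := by exact_mod_cast hd
    have hpow : (N : ℝ) ^ ((3 : ℝ) / 2) = N * √N := by
      rw [Real.sqrt_eq_rpow, show (3 : ℝ) / 2 = 1 + 1 / 2 by norm_num,
        Real.rpow_add (by linarith), Real.rpow_one]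
    have hfloor : (⌊2 * c * √N / ε⌋₊ : ℝ) ≤ 2 * c * √N / ε := Nat.floor_le (by positivity)
    set A := 2 * c * (N : ℝ) ^ ((3 : ℝ) / 2) / ε with hA
    have hA1 : 1 ≤ A := by
      rw [hA, le_div_iff₀ hε, one_mul]
      have : 1 ≤ (N : ℝ) ^ ((3 : ℝ) / 2) := Real.one_le_rpow hN1 (by norm_num)
      nlinarith
    have hs : (N * ⌊2 * c * √N / ε⌋₊ : ℝ) ≤ A := by
      calc (N * ⌊2 * c * √N / ε⌋₊ : ℝ) ≤ N * (2 * c * √N / ε) := by gcongr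
        _ = A := by rw [hA, hpow]; ring
    have hAd : 1 ≤ A * d := one_le_mul_of_one_le_of_one_le hA1 hd1
    calc (S.card : ℝ) ≤ (2 * (N * ⌊2 * c * √N / ε⌋₊ * d) + 1) ^ n := by exact_mod_cast hcard
      _ ≤ (2 * (A * d) + 1) ^ n := by gcongr
      _ ≤ (4 * d * (A * n)) ^ n := by
          gcongr
          nlinarith
      _ = 1 * ((4 * d) ^ n * (A * n) ^ n) := by rw [mul_pow, one_mul]
      _ ≤ (2 * (4 * d)) * ((4 * d) ^ n * (A * n) ^ n) := by
          gcongr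
          linarith
      _ = 2 * (4 * d) ^ (n + 1) * (2 * c * n * (N : ℝ) ^ ((3 : ℝ) / 2) / ε) ^ n := by
          rw [hA]
          ring
  calc volume {y : EuclideanSpace ℝ (Fin N) | ∃ v ∈ V, dist y v ≤ ε}
      ≤ ∑ x ∈ S, volume (Metric.closedBall (polyMap P x) (2 * ε)) :=
        (measure_mono hsub).trans (measure_biUnion_finset_le _ _)
    _ = ENNReal.ofReal (S.card * (2 * ε) ^ N) *
          volume (Metric.closedBall (0 : EuclideanSpace ℝ (Fin N)) 1) := by
        simp_rw [Measure.addHaar_closedBall' volume _ (by positivity : 0 ≤ 2 * ε)]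
        rw [Finset.sum_const, nsmul_eq_mul, finrank_euclideanSpace_fin, ← mul_assoc,
          ENNReal.ofReal_mul (Nat.cast_nonneg _), ENNReal.ofReal_natCast]
    _ ≤ _ := by gcongr
end

section
/- Let 1 ≤ k ≤ n be integers, let E and F be k-dimensional linear subspaces of ℝ^n with orthogonal projections P_E and P_F, and let ε ≥ 0 satisfy ‖P_E − P_F‖₂ ≤ ε, where ‖·‖₂ is the ℓ₂→ℓ₂ operator norm. Then for every matrix Q_E ∈ ℝ^{n×k} whose columns form an orthonormal basis of E, there exists a matrix Q_F ∈ ℝ^{n×k} whose columns form an orthonormal basis of F such that ‖Q_E − Q_F‖₂ ≤ √2·ε. -/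
/-- The `ℓ₂ → ℓ₂` operator norm of a real matrix. -/
noncomputable def matL2OpNorm {n k : ℕ} (A : Matrix (Fin n) (Fin k) ℝ) : ℝ :=
  ‖LinearMap.toContinuousLinearMap (Matrix.toEuclideanLin A)‖

/-- The `j`-th column of a matrix, as a vector of `ℝ^n` with the Euclidean norm. -/
def matCol {n k : ℕ} (A : Matrix (Fin n) (Fin k) ℝ) (j : Fin k) :
    EuclideanSpace ℝ (Fin n) :=
  WithLp.toLp 2 (fun i => A i j)

/-- The orthogonal projection of `ℝ^n` onto a subspace, as a continuous linear map
on the ambient space. -/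
noncomputable def orthProj {n : ℕ} (E : Submodule ℝ (EuclideanSpace ℝ (Fin n))) :
    EuclideanSpace ℝ (Fin n) →L[ℝ] EuclideanSpace ℝ (Fin n) :=
  E.subtypeL.comp (Submodule.orthogonalProjectionOnto E)

open Module

theorem LinearMap.exists_orthonormalBasis_apply_eq_smul
    {V W : Type*} [NormedAddCommGroup V] [InnerProductSpace ℝ V] [FiniteDimensional ℝ V]
    [NormedAddCommGroup W] [InnerProductSpace ℝ W] [FiniteDimensional ℝ W] {k : ℕ}
    (hV : finrank ℝ V = k) (hW : finrank ℝ W = k) (T : V →ₗ[ℝ] W) :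
    ∃ (b : OrthonormalBasis (Fin k) ℝ V) (f : OrthonormalBasis (Fin k) ℝ W) (s : Fin k → ℝ),
      (∀ i, 0 ≤ s i) ∧ ∀ i, T (b i) = s i • f i := by
  have hS : (T.adjoint ∘ₗ T).IsSymmetric := by
    intro x y
    simp [LinearMap.adjoint_inner_left, LinearMap.adjoint_inner_right]
  set b := hS.eigenvectorBasis hV
  have horth : ∀ i j, i ≠ j → inner ℝ (T (b i)) (T (b j)) = 0 := by
    intro i j hij
    rw [← LinearMap.adjoint_inner_left, ← LinearMap.comp_apply, hS.apply_eigenvectorBasis hV i,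
      inner_smul_left, b.orthonormal.inner_eq_zero hij, mul_zero]
  have hon : Orthonormal ℝ ({i | T (b i) ≠ 0}.domRestrict fun i => ‖T (b i)‖⁻¹ • T (b i)) := by
    refine ⟨fun i => ?_, fun i j hij => ?_⟩
    · have := norm_ne_zero_iff.mpr i.2
      simp [Set.domRestrict_apply, norm_smul, this]
    · simp [Set.domRestrict_apply, inner_smul_left, inner_smul_right,
        horth i j (fun h => hij (Subtype.ext h))]
  obtain ⟨f, hf⟩ := hon.exists_orthonormalBasis_extension_of_card_eq (by simp [hW])
  refine ⟨b, f, fun i => ‖T (b i)‖, fun i => norm_nonneg _, fun i => ?_⟩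
  by_cases h : T (b i) = 0
  · simp [h]
  · rw [hf i h, smul_smul, mul_inv_cancel₀ (norm_ne_zero_iff.mpr h), one_smul]

theorem LinearMap.exists_linearIsometryEquiv_norm_sq_le_inner
    {V W : Type*} [NormedAddCommGroup V] [InnerProductSpace ℝ V] [FiniteDimensional ℝ V]
    [NormedAddCommGroup W] [InnerProductSpace ℝ W] [FiniteDimensional ℝ W]
    (hVW : finrank ℝ V = finrank ℝ W) (T : V →ₗ[ℝ] W) (hT : ∀ x, ‖T x‖ ≤ ‖x‖) :
    ∃ U : V ≃ₗᵢ[ℝ] W, ∀ x, ‖T x‖ ^ 2 ≤ inner ℝ (T x) (U x) := by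
  obtain ⟨b, f, s, hs, hTb⟩ := T.exists_orthonormalBasis_apply_eq_smul hVW rfl
  have hs1 : ∀ i, s i ≤ 1 := fun i => by
    simpa [hTb, norm_smul, abs_of_nonneg (hs i)] using hT (b i)
  refine ⟨b.equiv f (Equiv.refl _), fun x => ?_⟩
  have hcoordT : ∀ i, inner ℝ (T x) (f i) = s i * inner ℝ (b i) x := fun i => by
    conv_lhs => rw [← b.sum_repr' x]
    simp [sum_inner, inner_smul_left, hTb, f.inner_eq_ite, mul_comm]
  have hcoordU : ∀ i, inner ℝ (f i) (b.equiv f (Equiv.refl _) x) = inner ℝ (b i) x := fun i => by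
    rw [← LinearIsometryEquiv.inner_map_map (b.equiv f (Equiv.refl _)) (b i) x]
    simp
  rw [← real_inner_self_eq_norm_sq, ← f.sum_inner_mul_inner, ← f.sum_inner_mul_inner (T x)]
  refine Finset.sum_le_sum fun i _ => ?_
  rw [hcoordU, real_inner_comm (T x), hcoordT]
  nlinarith [mul_nonneg (mul_nonneg (hs i) (sub_nonneg.2 (hs1 i))) (sq_nonneg (inner ℝ (b i) x))]

theorem Submodule.exists_linearIsometryEquiv_norm_sub_le
    {V : Type*} [NormedAddCommGroup V] [InnerProductSpace ℝ V] (E F : Submodule ℝ V)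
    [FiniteDimensional ℝ E] [FiniteDimensional ℝ F] (h : finrank ℝ E = finrank ℝ F) :
    ∃ U : E ≃ₗᵢ[ℝ] F, ∀ x : E,
      ‖(x : V) - U x‖ ≤ √2 * ‖(x : V) - F.orthogonalProjectionOnto (x : V)‖ := by
  obtain ⟨U, hU⟩ := LinearMap.exists_linearIsometryEquiv_norm_sq_le_inner h
    (F.orthogonalProjectionOnto.toLinearMap ∘ₗ E.subtype)
    fun x => F.norm_orthogonalProjectionOnto_apply_le (x : V)
  refine ⟨U, fun x => ?_⟩
  have hx := hU x
  simp only [LinearMap.comp_apply, ContinuousLinearMap.coe_coe, Submodule.subtype_apply,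
    Submodule.inner_orthogonalProjectionOnto_eq_of_mem_right] at hx
  have hpx : inner ℝ (x : V) (F.orthogonalProjectionOnto (x : V) : V)
      = ‖F.orthogonalProjectionOnto (x : V)‖ ^ 2 := by
    rw [← Submodule.inner_orthogonalProjectionOnto_eq_of_mem_right, real_inner_self_eq_norm_sq]
  refine le_of_sq_le_sq ?_ (by positivity)
  have hUx : ‖(U x : V)‖ = ‖(x : V)‖ := U.norm_map x
  rw [mul_pow, Real.sq_sqrt zero_le_two, norm_sub_sq_real, norm_sub_sq_real, hpx, hUx]
  rw [Submodule.coe_norm] at hx ⊢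
  linarith

theorem toEuclideanLin_eq_sum_smul_matCol {n k : ℕ} (A : Matrix (Fin n) (Fin k) ℝ)
    (v : EuclideanSpace ℝ (Fin k)) :
    Matrix.toEuclideanLin A v = ∑ j, v j • matCol A j := by
  ext i
  simp [matCol, Matrix.toLpLin_apply, Matrix.mulVec, dotProduct, mul_comm]

/-- If the orthogonal projections onto two `k`-dimensional subspaces `E, F ⊆ ℝ^n`
differ by at most `ε` in operator norm, then any orthonormal basis matrix of `E`
is within `√2·ε` (in operator norm) of some orthonormal basis matrix of `F`. -/
theorem grassmann_to_stiefel (n k : ℕ) (hk : 1 ≤ k) (hkn : k ≤ n)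
    (E F : Submodule ℝ (EuclideanSpace ℝ (Fin n)))
    (hE : Module.finrank ℝ E = k) (hF : Module.finrank ℝ F = k)
    (ε : ℝ) (hε : 0 ≤ ε) (hPEF : ‖orthProj E - orthProj F‖ ≤ ε)
    (QE : Matrix (Fin n) (Fin k) ℝ)
    (hQE1 : Orthonormal ℝ (matCol QE))
    (hQE2 : Submodule.span ℝ (Set.range (matCol QE)) = E) :
    ∃ QF : Matrix (Fin n) (Fin k) ℝ,
      Orthonormal ℝ (matCol QF) ∧
      Submodule.span ℝ (Set.range (matCol QF)) = F ∧
      matL2OpNorm (QE - QF) ≤ Real.sqrt 2 * ε := by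
  obtain ⟨U, hU⟩ := E.exists_linearIsometryEquiv_norm_sub_le F (hE.trans hF.symm)
  have hmem : ∀ j, matCol QE j ∈ E := fun j => hQE2 ▸ Submodule.subset_span ⟨j, rfl⟩
  let QF : Matrix (Fin n) (Fin k) ℝ := fun i j => (U ⟨matCol QE j, hmem j⟩ : EuclideanSpace ℝ _) i
  have hcol : ∀ j, matCol QF j = U ⟨matCol QE j, hmem j⟩ := fun j => rfl
  have hon : Orthonormal ℝ (matCol QF) := by
    have h : Orthonormal ℝ fun j => (⟨matCol QE j, hmem j⟩ : E) :=
      (E.subtypeₗᵢ.orthonormal_comp_iff).1 hQE1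
    exact (h.comp_linearIsometryEquiv U).comp_linearIsometry F.subtypeₗᵢ
  refine ⟨QF, hon, ?_, ?_⟩
  · refine Submodule.eq_of_le_of_finrank_eq ?_ ?_
    · rw [Submodule.span_le]
      rintro _ ⟨j, rfl⟩
      exact (U ⟨matCol QE j, hmem j⟩).2
    · rw [finrank_span_eq_card hon.linearIndependent, hF, Fintype.card_fin]
  · refine ContinuousLinearMap.opNorm_le_bound _ (by positivity) fun v => ?_
    let x : E := ∑ j, v j • ⟨matCol QE j, hmem j⟩
    have hx : (x : EuclideanSpace ℝ (Fin n)) = ∑ j, v j • matCol QE j := by simp [x]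
    have hUx : (U x : EuclideanSpace ℝ (Fin n)) = ∑ j, v j • matCol QF j := by
      simp only [x, hcol, map_sum, map_smul, Submodule.coe_sum, Submodule.coe_smul]
    have hnorm : ‖(x : EuclideanSpace ℝ (Fin n))‖ = ‖v‖ := by
      rw [← sq_eq_sq₀ (norm_nonneg _) (norm_nonneg _), hx, ← real_inner_self_eq_norm_sq,
        hQE1.inner_sum, EuclideanSpace.real_norm_sq_eq]
      simp [sq]
    have hproj : ‖(x : EuclideanSpace ℝ (Fin n)) - F.orthogonalProjectionOnto x‖ ≤ ε * ‖v‖ := by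
      have h := (orthProj E - orthProj F).le_of_opNorm_le hPEF x
      simpa [orthProj, hnorm] using h
    calc ‖Matrix.toEuclideanLin (QE - QF) v‖
        = ‖(x : EuclideanSpace ℝ (Fin n)) - U x‖ := by
          rw [map_sub, LinearMap.sub_apply, toEuclideanLin_eq_sum_smul_matCol,
            toEuclideanLin_eq_sum_smul_matCol, hx, hUx]
      _ ≤ √2 * (ε * ‖v‖) := (hU x).trans (by gcongr)
      _ = √2 * ε * ‖v‖ := (mul_assoc _ _ _).symm
end
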